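/- Let Π be a polar space of rank n ≥ 3 and 0 ≤ k ≤ n−1. For any two k-dimensional singular subspaces S and U of Π there exists a base B of Π such that the base subset of G_k associated with B contains both S and U. -/

import Mathlib

/- Common framework: polar spaces of rank `n`, singular subspaces, projective
dimension, Grassmannians, bases and base subsets, inexact/complement subsets,
following Pankov, "Base subsets of polar Grassmannians". -/

namespace PolarGeo

variable {P : Type*}

/-- The (reflexive) collinearity relation determined by a family of lines. -/
def Col (lines : Set (Set P)) (p q : P) : Prop :=
  p = q ∨ ∃ L ∈ lines, p ∈ L ∧ q ∈ L

/-- `S` is a subspace: it contains every line through two of its distinct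
collinear points. -/
def IsSubspace (lines : Set (Set P)) (S : Set P) : Prop :=
  ∀ p ∈ S, ∀ q ∈ S, p ≠ q → ∀ L ∈ lines, p ∈ L → q ∈ L → L ⊆ S

/-- A singular subspace: a subspace whose points are mutually collinear. -/
def IsSingular (lines : Set (Set P)) (S : Set P) : Prop :=
  IsSubspace lines S ∧ ∀ p ∈ S, ∀ q ∈ S, Col lines p q

/-- A flag: a chain of nonempty singular subspaces. -/
def IsFlag (lines : Set (Set P)) (C : Set (Set P)) : Prop :=
  IsChain (· ⊆ ·) C ∧ ∀ T ∈ C, IsSingular lines T ∧ T.Nonempty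

/-- A polar space of rank `n` on the point set `P`: a partial linear space
such that every point is collinear with one or all points of every line, no
point is collinear with all others, and every maximal flag of singular
subspaces consists of `n` elements. -/
structure PolarSpace (P : Type*) (n : ℕ) where
  lines : Set (Set P)
  line_proper : ∀ L ∈ lines, L ≠ (Set.univ : Set P)
  line_two : ∀ L ∈ lines, ∃ p ∈ L, ∃ q ∈ L, p ≠ q
  point_on_line : ∀ p : P, ∃ L ∈ lines, p ∈ L
  unique_line : ∀ p q : P, p ≠ q → ∀ L₁ ∈ lines, ∀ L₂ ∈ lines,
    p ∈ L₁ → q ∈ L₁ → p ∈ L₂ → q ∈ L₂ → L₁ = L₂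
  one_or_all : ∀ p : P, ∀ L ∈ lines,
    (∃! q, q ∈ L ∧ Col lines p q) ∨ ∀ q ∈ L, Col lines p q
  no_center : ∀ p : P, ∃ q : P, ¬ Col lines p q
  flag_card : ∀ C : Set (Set P), IsFlag lines C →
    (∀ C', IsFlag lines C' → C ⊆ C' → C = C') → C.ncard = n

/-- A flag all of whose members are contained in `S`. -/
def IsFlagIn (lines : Set (Set P)) (S : Set P) (C : Set (Set P)) : Prop :=
  IsFlag lines C ∧ ∀ T ∈ C, T ⊆ S

/-- `S` is a singular subspace of projective dimension `m` (so `dim ∅ = -1`):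
a maximal chain of nonempty singular subspaces contained in `S` has `m + 1`
members. -/
def HasDim (lines : Set (Set P)) (S : Set P) (m : ℤ) : Prop :=
  IsSingular lines S ∧ ∃ C : Set (Set P), IsFlagIn lines S C ∧
    (∀ C', IsFlagIn lines S C' → C ⊆ C' → C = C') ∧
    C.Finite ∧ (C.ncard : ℤ) = m + 1

/-- The Grassmannian `G_m` of `m`-dimensional singular subspaces. -/
def Gdim (lines : Set (Set P)) (m : ℤ) : Set (Set P) := {S | HasDim lines S m}

/-- The span of `X`: the smallest subspace containing `X`. -/
def span (lines : Set (Set P)) (X : Set P) : Set P :=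
  ⋂₀ {S : Set P | IsSubspace lines S ∧ X ⊆ S}

/-- `X ⊥`: the set of points collinear with every point of `X`. -/
def perp (lines : Set (Set P)) (X : Set P) : Set P :=
  {y | ∀ x ∈ X, Col lines x y}

/-- A base of the polar space: `2n` points each of which is non-collinear
with exactly one of them. -/
def IsBase (lines : Set (Set P)) {n : ℕ} (p : Fin (2 * n) → P) : Prop :=
  Function.Injective p ∧ ∀ i, ∃! j, ¬ Col lines (p i) (p j)

/-- The base subset of `G_k` associated with a base: all `k`-dimensional
singular subspaces spanned by points of the base. -/
def baseSubset (lines : Set (Set P)) {n : ℕ} (p : Fin (2 * n) → P) (k : ℤ) :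
    Set (Set P) :=
  {S | HasDim lines S k ∧ ∃ I : Set (Fin (2 * n)), S = span lines (p '' I)}

/-- `𝓑(+x)`: the elements of `𝓑` containing the point `x`. -/
def plus (𝓑 : Set (Set P)) (x : P) : Set (Set P) := {S ∈ 𝓑 | x ∈ S}

/-- `𝓑(-x)`: the elements of `𝓑` not containing the point `x`. -/
def minus (𝓑 : Set (Set P)) (x : P) : Set (Set P) := {S ∈ 𝓑 | x ∉ S}

/-- `R ⊆ 𝓑` is inexact: some base subset of `G_k` different from `𝓑`
contains `R`. -/
def IsInexact (lines : Set (Set P)) (n : ℕ) (k : ℤ) (𝓑 R : Set (Set P)) : Prop :=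
  R ⊆ 𝓑 ∧ ∃ p' : Fin (2 * n) → P, IsBase lines p' ∧
    R ⊆ baseSubset lines p' k ∧ baseSubset lines p' k ≠ 𝓑

/-- `R ⊆ 𝓑` is exact: `𝓑` is the only base subset of `G_k` containing `R`. -/
def IsExact (lines : Set (Set P)) (n : ℕ) (k : ℤ) (𝓑 R : Set (Set P)) : Prop :=
  R ⊆ 𝓑 ∧ ∀ p' : Fin (2 * n) → P, IsBase lines p' →
    R ⊆ baseSubset lines p' k → baseSubset lines p' k = 𝓑

/-- A maximal inexact subset of `𝓑`. -/
def IsMaxInexact (lines : Set (Set P)) (n : ℕ) (k : ℤ) (𝓑 R : Set (Set P)) : Prop :=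
  IsInexact lines n k 𝓑 R ∧ ∀ R', IsInexact lines n k 𝓑 R' → R ⊆ R' → R = R'

/-- A complement subset of `𝓑`: the complement of a maximal inexact subset. -/
def IsComplement (lines : Set (Set P)) (n : ℕ) (k : ℤ) (𝓑 R : Set (Set P)) : Prop :=
  R ⊆ 𝓑 ∧ IsMaxInexact lines n k 𝓑 (𝓑 \ R)

/-- Type `C`: every `(n-2)`-dimensional singular subspace is contained in at
least `3` maximal singular subspaces. -/
def TypeC (lines : Set (Set P)) (n : ℕ) : Prop :=
  ∀ S ∈ Gdim lines ((n : ℤ) - 2), ∃ M₁ ∈ Gdim lines ((n : ℤ) - 1),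
    ∃ M₂ ∈ Gdim lines ((n : ℤ) - 1), ∃ M₃ ∈ Gdim lines ((n : ℤ) - 1),
      M₁ ≠ M₂ ∧ M₁ ≠ M₃ ∧ M₂ ≠ M₃ ∧ S ⊆ M₁ ∧ S ⊆ M₂ ∧ S ⊆ M₃

/-- Type `D`: every `(n-2)`-dimensional singular subspace is contained in
exactly `2` maximal singular subspaces. -/
def TypeD (lines : Set (Set P)) (n : ℕ) : Prop :=
  ∀ S ∈ Gdim lines ((n : ℤ) - 2),
    {M | M ∈ Gdim lines ((n : ℤ) - 1) ∧ S ⊆ M}.ncard = 2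

/-- A collineation of a point-line geometry on the whole type: a bijection
preserving the family of lines in both directions. -/
def IsCollineation (lines : Set (Set P)) (f : P → P) : Prop :=
  Function.Bijective f ∧ ∀ L : Set P, L ∈ lines ↔ f '' L ∈ lines

/-- A collineation of a partial linear space whose point set is the subset
`pts` of `X`: a bijection of `pts` mapping the family of lines onto itself in
both directions. -/
def IsCollineationOn {X : Type*} (pts : Set X) (lns : Set (Set X)) (f : X → X) : Prop :=
  Set.BijOn f pts pts ∧ (∀ ℓ ∈ lns, f '' ℓ ∈ lns) ∧
    (∀ ℓ ∈ lns, ∃ ℓ' ∈ lns, f '' ℓ' = ℓ)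

/-- Lines of the Grassmann space `𝔊_k`. For `k ≤ n - 2` a line is given by
incident `S ∈ G_{k-1}`, `U ∈ G_{k+1}` (for `k = 0` this is the shadow of an
element of `G_1`); for `k = n - 1` a line is given by an element of
`G_{n-2}`. -/
def grassLines (lines : Set (Set P)) (n k : ℕ) : Set (Set (Set P)) :=
  if k = n - 1 then
    {ℓ | ∃ S ∈ Gdim lines ((n : ℤ) - 2),
      ℓ = {T | T ∈ Gdim lines ((n : ℤ) - 1) ∧ S ⊆ T}}
  else
    {ℓ | ∃ S ∈ Gdim lines ((k : ℤ) - 1), ∃ U ∈ Gdim lines ((k : ℤ) + 1),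
      S ⊆ U ∧ ℓ = {T | T ∈ Gdim lines (k : ℤ) ∧ S ⊆ T ∧ T ⊆ U}}

/-- Collinearity of distinct points of `𝔊_k` for `k ≤ n - 2`: `S ⊥ U` and
the span of `S ∪ U` is `(k+1)`-dimensional. -/
def GColl (lines : Set (Set P)) (k : ℤ) (S U : Set P) : Prop :=
  S ≠ U ∧ (∀ a ∈ S, ∀ b ∈ U, Col lines a b) ∧
    span lines (S ∪ U) ∈ Gdim lines (k + 1)

/-- Weak adjacency in `G_k`: the intersection is `(k-1)`-dimensional. -/
def WeakAdj (lines : Set (Set P)) (k : ℤ) (S U : Set P) : Prop :=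
  S ∩ U ∈ Gdim lines (k - 1)

/-- The complement subset `C_{ij} = 𝓑(+i,-j) ∪ 𝓑(+σ(j),-σ(i))` of second
type. -/
def Cij (lines : Set (Set P)) {n : ℕ} (p : Fin (2 * n) → P)
    (σ : Fin (2 * n) → Fin (2 * n)) (k : ℤ) (i j : Fin (2 * n)) : Set (Set P) :=
  (plus (baseSubset lines p k) (p i) ∩ minus (baseSubset lines p k) (p j)) ∪
  (plus (baseSubset lines p k) (p (σ j)) ∩ minus (baseSubset lines p k) (p (σ i)))

/-- The inexact subset
`R_{ij} = 𝓑(+i,+j) ∪ 𝓑(+σ(i),+σ(j)) ∪ 𝓑(-i,-σ(j))` of second type. -/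
def Rij (lines : Set (Set P)) {n : ℕ} (p : Fin (2 * n) → P)
    (σ : Fin (2 * n) → Fin (2 * n)) (k : ℤ) (i j : Fin (2 * n)) : Set (Set P) :=
  (plus (baseSubset lines p k) (p i) ∩ plus (baseSubset lines p k) (p j)) ∪
  (plus (baseSubset lines p k) (p (σ i)) ∩ plus (baseSubset lines p k) (p (σ j))) ∪
  (minus (baseSubset lines p k) (p i) ∩ minus (baseSubset lines p k) (p (σ j)))

/-- `c(S,U)`: the number of complement subsets of second type of the base
subset containing both `S` and `U`. -/
noncomputable def cCount (lines : Set (Set P)) {n : ℕ} (p : Fin (2 * n) → P)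
    (σ : Fin (2 * n) → Fin (2 * n)) (k : ℤ) (S U : Set P) : ℕ :=
  {R : Set (Set P) | (∃ i j, j ≠ i ∧ j ≠ σ i ∧ R = Cij lines p σ k i j) ∧
    S ∈ R ∧ U ∈ R}.ncard

/-- `O_+`, `O_-` form the half-spin partition of `G_{n-1}`: two maximal
singular subspaces lie in the same class iff `n - dim (S ∩ U)` is odd. -/
def IsHalfSpinPair (lines : Set (Set P)) (n : ℕ) (Opos Oneg : Set (Set P)) : Prop :=
  Opos.Nonempty ∧ Oneg.Nonempty ∧ Disjoint Opos Oneg ∧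
  Opos ∪ Oneg = Gdim lines ((n : ℤ) - 1) ∧
  ∀ S ∈ Gdim lines ((n : ℤ) - 1), ∀ U ∈ Gdim lines ((n : ℤ) - 1),
    ((S ∈ Opos ↔ U ∈ Opos) ↔ ∃ m : ℤ, HasDim lines (S ∩ U) m ∧ Odd ((n : ℤ) - m))

/-- The base subset of `O_δ` associated with a base. -/
def baseSubsetO (lines : Set (Set P)) (n : ℕ) (Oδ : Set (Set P))
    (p : Fin (2 * n) → P) : Set (Set P) :=
  Oδ ∩ baseSubset lines p ((n : ℤ) - 1)

/-- `R ⊆ 𝓑` is inexact in `O_δ`: some base subset of `O_δ` different from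
`𝓑` contains `R`. -/
def IsInexactO (lines : Set (Set P)) (n : ℕ) (Oδ : Set (Set P))
    (𝓑 R : Set (Set P)) : Prop :=
  R ⊆ 𝓑 ∧ ∃ p' : Fin (2 * n) → P, IsBase lines p' ∧
    R ⊆ baseSubsetO lines n Oδ p' ∧ baseSubsetO lines n Oδ p' ≠ 𝓑

/-- A maximal inexact subset of a base subset `𝓑` of `O_δ`. -/
def IsMaxInexactO (lines : Set (Set P)) (n : ℕ) (Oδ : Set (Set P))
    (𝓑 R : Set (Set P)) : Prop :=
  IsInexactO lines n Oδ 𝓑 R ∧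
    ∀ R', IsInexactO lines n Oδ 𝓑 R' → R ⊆ R' → R = R'

/-- A complement subset of a base subset `𝓑` of `O_δ`. -/
def IsComplementO (lines : Set (Set P)) (n : ℕ) (Oδ : Set (Set P))
    (𝓑 R : Set (Set P)) : Prop :=
  R ⊆ 𝓑 ∧ IsMaxInexactO lines n Oδ 𝓑 (𝓑 \ R)

/-- Lines of the half-spin space `𝔒_δ`: sets of all elements of `O_δ`
containing a fixed `(n-3)`-dimensional singular subspace. -/
def halfSpinLines (lines : Set (Set P)) (n : ℕ) (Oδ : Set (Set P)) :
    Set (Set (Set P)) :=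
  {ℓ | ∃ S ∈ Gdim lines ((n : ℤ) - 3), ℓ = {T | T ∈ Oδ ∧ S ⊆ T}}

end PolarGeo

open PolarGeo

namespace PolarGeo

section Helpers

variable {P : Type*} {n : ℕ}

theorem col_symm {l : Set (Set P)} {p q : P} (h : Col l p q) : Col l q p := by
  rcases h with h | ⟨L, hL, hp, hq⟩
  · exact Or.inl h.symm
  · exact Or.inr ⟨L, hL, hq, hp⟩

theorem col_refl {l : Set (Set P)} (p : P) : Col l p p := Or.inl rfl

theorem perp_subspace (Pol : PolarSpace P n) (X : Set P) :
    IsSubspace Pol.lines (perp Pol.lines X) := by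
  intro a ha b hb hab L hL haL hbL c hc x hx
  rcases Pol.one_or_all x L hL with ⟨q, _, hq⟩ | h
  · exact absurd ((hq a ⟨haL, ha x hx⟩).trans (hq b ⟨hbL, hb x hx⟩).symm) hab
  · exact h c hc

theorem subset_span {l : Set (Set P)} (X : Set P) : X ⊆ span l X :=
  fun _ hx _ hS => hS.2 hx

theorem span_subspace {l : Set (Set P)} (X : Set P) : IsSubspace l (span l X) :=
  fun p hp q hq hpq L hL hpL hqL _ hx S hS =>
    hS.1 p (hp S hS) q (hq S hS) hpq L hL hpL hqL hx

theorem span_le {l : Set (Set P)} {X S : Set P} (hS : IsSubspace l S) (h : X ⊆ S) :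
    span l X ⊆ S := fun _ hx => hx S ⟨hS, h⟩

theorem span_mono {l : Set (Set P)} {X Y : Set P} (h : X ⊆ Y) : span l X ⊆ span l Y :=
  span_le (span_subspace Y) (h.trans (subset_span Y))

theorem span_self {l : Set (Set P)} {S : Set P} (hS : IsSubspace l S) : span l S = S :=
  (span_le hS subset_rfl).antisymm (subset_span S)

theorem span_union_span {l : Set (Set P)} (X Y : Set P) :
    span l (span l X ∪ Y) = span l (X ∪ Y) := by
  apply Set.Subset.antisymm
  · refine span_le (span_subspace _) (Set.union_subset (span_mono Set.subset_union_left) ?_)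
    exact Set.subset_union_right.trans (subset_span _)
  · exact span_mono (Set.union_subset_union_left _ (subset_span _))

theorem span_union_span' {l : Set (Set P)} (X Y : Set P) :
    span l (Y ∪ span l X) = span l (Y ∪ X) := by
  rw [Set.union_comm, span_union_span, Set.union_comm]

theorem perp_anti {l : Set (Set P)} {X Y : Set P} (h : X ⊆ Y) : perp l Y ⊆ perp l X :=
  fun _ hy x hx => hy x (h hx)

theorem perp_union {l : Set (Set P)} (X Y : Set P) :
    perp l (X ∪ Y) = perp l X ∩ perp l Y := by
  ext z; constructor
  · intro h
    exact ⟨fun x hx => h x (Or.inl hx), fun x hx => h x (Or.inr hx)⟩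
  · rintro ⟨h1, h2⟩ x (hx | hx)
    · exact h1 x hx
    · exact h2 x hx

theorem subset_perp_comm {l : Set (Set P)} {X Y : Set P} (h : X ⊆ perp l Y) :
    Y ⊆ perp l X := fun _ hy _ hx => col_symm (h hx _ hy)

theorem perp_span (Pol : PolarSpace P n) (X : Set P) :
    perp Pol.lines (span Pol.lines X) = perp Pol.lines X := by
  apply Set.Subset.antisymm (perp_anti (subset_span X))
  intro y hy x hx
  have h : X ⊆ perp Pol.lines {y} := by
    intro z hz w hw
    rw [Set.mem_singleton_iff] at hw
    subst hw
    exact col_symm (hy z hz)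
  exact col_symm (span_le (perp_subspace Pol _) h hx y rfl)

theorem sing_perp {l : Set (Set P)} {S : Set P} (h : IsSingular l S) : S ⊆ perp l S :=
  fun y hy x hx => h.2 x hx y hy

theorem span_sing (Pol : PolarSpace P n) {X : Set P} (h : X ⊆ perp Pol.lines X) :
    IsSingular Pol.lines (span Pol.lines X) := by
  refine ⟨span_subspace X, fun p hp q hq => ?_⟩
  have h1 : span Pol.lines X ⊆ perp Pol.lines (span Pol.lines X) := by
    rw [perp_span]
    exact span_le (perp_subspace Pol X) h
  exact h1 hq p hp

theorem inter_subspace {l : Set (Set P)} {S T : Set P} (hS : IsSubspace l S)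
    (hT : IsSubspace l T) : IsSubspace l (S ∩ T) :=
  fun p hp q hq hpq L hL hpL hqL _ hx =>
    ⟨hS p hp.1 q hq.1 hpq L hL hpL hqL hx, hT p hp.2 q hq.2 hpq L hL hpL hqL hx⟩

theorem inter_sing {l : Set (Set P)} {S T : Set P} (hS : IsSingular l S)
    (hT : IsSubspace l T) : IsSingular l (S ∩ T) :=
  ⟨inter_subspace hS.1 hT, fun p hp q hq => hS.2 p hp.1 q hq.1⟩

theorem inter_perp_sing (Pol : PolarSpace P n) {S : Set P} (hS : IsSingular Pol.lines S)
    (X : Set P) : IsSingular Pol.lines (S ∩ perp Pol.lines X) :=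
  inter_sing hS (perp_subspace Pol X)

theorem empty_sing (l : Set (Set P)) : IsSingular l ∅ :=
  ⟨fun _ h => h.elim, fun _ h => h.elim⟩

theorem empty_flag (l : Set (Set P)) : IsFlag l ∅ :=
  ⟨Set.pairwise_empty _, fun _ h => h.elim⟩

/-- Every flag is contained in a maximal one, hence is finite. -/
theorem flag_finite (Pol : PolarSpace P n) (hn : 3 ≤ n) {C : Set (Set P)}
    (hC : IsFlag Pol.lines C) : C.Finite ∧ C.ncard ≤ n := by
  obtain ⟨D, hCD, hD⟩ := zorn_subset_nonempty {C | IsFlag Pol.lines C} (by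
    intro c hc hch _
    refine ⟨⋃₀ c, ⟨?_, ?_⟩, fun s hs => Set.subset_sUnion_of_mem hs⟩
    · rintro F ⟨s, hs, hF⟩ G ⟨t, ht, hG⟩ hFG
      rcases hch.total hs ht with h | h
      · exact (hc ht).1 (h hF) hG hFG
      · exact (hc hs).1 hF (h hG) hFG
    · rintro T ⟨s, hs, hT⟩
      exact (hc hs).2 T hT) C hC
  have h1 : D.ncard = n := Pol.flag_card D hD.1 (fun C' hC' h =>
    h.antisymm (hD.2 hC' h))
  have h2 : D.Finite := Set.finite_of_ncard_ne_zero (by omega)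
  exact ⟨h2.subset hCD, h1 ▸ Set.ncard_le_ncard hCD h2⟩

/-- In a nonempty family of flags there is one of maximal cardinality. -/
theorem exists_max_flag (Pol : PolarSpace P n) (hn : 3 ≤ n) (p : Set (Set P) → Prop)
    (hp : ∀ C, p C → IsFlag Pol.lines C) (C₀ : Set (Set P)) (h0 : p C₀) :
    ∃ C, p C ∧ ∀ C', p C' → C'.ncard ≤ C.ncard := by
  have hb : BddAbove (Set.ncard '' {C | p C}) := by
    refine ⟨n, ?_⟩
    rintro _ ⟨C, hC, rfl⟩
    exact (flag_finite Pol hn (hp C hC)).2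
  obtain ⟨C, hC, h⟩ := Nat.sSup_mem (Set.Nonempty.image Set.ncard ⟨C₀, h0⟩) hb
  refine ⟨C, hC, fun C' hC' => ?_⟩
  rw [h]
  exact le_csSup hb ⟨C', hC', rfl⟩

/-- The rank of a singular subspace: the maximal length of a flag in it. -/
noncomputable def rk (l : Set (Set P)) (S : Set P) : ℕ :=
  sSup (Set.ncard '' {C | IsFlagIn l S C})

theorem rk_spec (Pol : PolarSpace P n) (hn : 3 ≤ n) (S : Set P) :
    ∃ C, IsFlagIn Pol.lines S C ∧ C.ncard = rk Pol.lines S ∧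
      ∀ C', IsFlagIn Pol.lines S C' → C'.ncard ≤ rk Pol.lines S := by
  obtain ⟨C, hC, h⟩ := exists_max_flag Pol hn (fun C => IsFlagIn Pol.lines S C)
    (fun C hC => hC.1) ∅ ⟨empty_flag _, fun _ h => h.elim⟩
  have : rk Pol.lines S = C.ncard := by
    refine IsGreatest.csSup_eq ⟨⟨C, hC, rfl⟩, ?_⟩
    rintro _ ⟨C', hC', rfl⟩
    exact h C' hC'
  exact ⟨C, hC, this.symm, this ▸ h⟩

theorem flag_insert {l : Set (Set P)} {C : Set (Set P)} (hC : IsFlag l C) {F : Set P}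
    (hF : IsSingular l F) (hne : F.Nonempty) (h : ∀ T ∈ C, F ⊆ T ∨ T ⊆ F) :
    IsFlag l (insert F C) := by
  refine ⟨hC.1.insert (fun b hb _ => h b hb), ?_⟩
  rintro T (rfl | hT)
  · exact ⟨hF, hne⟩
  · exact hC.2 T hT

/-- A flag of maximal cardinality contains everything comparable with it. -/
theorem mem_max_flag (Pol : PolarSpace P n) (hn : 3 ≤ n) {S F : Set P} {C : Set (Set P)}
    (hC : IsFlagIn Pol.lines S C) (hm : C.ncard = rk Pol.lines S)
    (hF : IsSingular Pol.lines F) (hne : F.Nonempty) (hFS : F ⊆ S)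
    (h : ∀ T ∈ C, F ⊆ T ∨ T ⊆ F) : F ∈ C := by
  by_contra hn'
  obtain ⟨_, _, _, h2⟩ := rk_spec Pol hn S
  have h3 := h2 (insert F C) ⟨flag_insert hC.1 hF hne h, by
    rintro T (rfl | hT)
    · exact hFS
    · exact hC.2 T hT⟩
  rw [Set.ncard_insert_of_notMem hn' (flag_finite Pol hn hC.1).1] at h3
  omega

theorem rk_le (Pol : PolarSpace P n) (hn : 3 ≤ n) (S : Set P) : rk Pol.lines S ≤ n := by
  obtain ⟨C, hC, h, _⟩ := rk_spec Pol hn S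
  exact h ▸ (flag_finite Pol hn hC.1).2

theorem rk_lt (Pol : PolarSpace P n) (hn : 3 ≤ n) {S T : Set P}
    (hT : IsSingular Pol.lines T) (h : S ⊂ T) : rk Pol.lines S < rk Pol.lines T := by
  obtain ⟨C, hC, h1, _⟩ := rk_spec Pol hn S
  obtain ⟨_, _, _, h2⟩ := rk_spec Pol hn T
  have h3 := h2 (insert T C) ⟨flag_insert hC.1 hT ((Set.nonempty_of_ssubset h).mono Set.sdiff_subset)
    (fun F hF => Or.inr ((hC.2 F hF).trans h.1)), by
    rintro F (rfl | hF)
    · exact subset_rfl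
    · exact (hC.2 F hF).trans h.1⟩
  rw [Set.ncard_insert_of_notMem (fun hh => h.2 (hC.2 T hh)) (flag_finite Pol hn hC.1).1] at h3
  omega

theorem rk_mono (Pol : PolarSpace P n) (hn : 3 ≤ n) {S T : Set P}
    (hT : IsSingular Pol.lines T) (h : S ⊆ T) : rk Pol.lines S ≤ rk Pol.lines T := by
  rcases h.eq_or_ssubset with rfl | h
  · exact le_rfl
  · exact (rk_lt Pol hn hT h).le

theorem eq_of_rk_le (Pol : PolarSpace P n) (hn : 3 ≤ n) {S T : Set P}
    (hT : IsSingular Pol.lines T) (h : S ⊆ T) (hr : rk Pol.lines T ≤ rk Pol.lines S) :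
    S = T := by
  rcases h.eq_or_ssubset with h | h
  · exact h
  · exact absurd (rk_lt Pol hn hT h) (by omega)

theorem rk_empty (Pol : PolarSpace P n) (hn : 3 ≤ n) : rk Pol.lines (∅ : Set P) = 0 := by
  obtain ⟨C, hC, h, _⟩ := rk_spec Pol hn (∅ : Set P)
  rw [← h]
  have : C = ∅ := by
    rw [Set.eq_empty_iff_forall_notMem]
    intro T hT
    obtain ⟨x, hx⟩ := (hC.1.2 T hT).2
    exact hC.2 T hT hx
  simp [this]

theorem nonempty_of_rk_pos (Pol : PolarSpace P n) (hn : 3 ≤ n) {S : Set P}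
    (h : 0 < rk Pol.lines S) : S.Nonempty := by
  by_contra h'
  rw [Set.not_nonempty_iff_eq_empty] at h'
  rw [h', rk_empty Pol hn] at h
  omega

/-- Jordan–Hölder: a maximal proper subspace has rank one less. -/
theorem rk_cover (Pol : PolarSpace P n) (hn : 3 ≤ n) {S T : Set P}
    (hT : IsSingular Pol.lines T) (hS : IsSingular Pol.lines S) (hST : S ⊂ T)
    (hcov : ∀ F, IsSingular Pol.lines F → S ⊆ F → F ⊆ T → F = S ∨ F = T) :
    rk Pol.lines T = rk Pol.lines S + 1 := by
  obtain ⟨C, hC, hC1, -⟩ := rk_spec Pol hn T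
  obtain ⟨D, hD, hD1, -⟩ := rk_spec Pol hn S
  obtain ⟨E, ⟨hE, hET⟩, hEm⟩ := exists_max_flag Pol hn
    (fun E => IsFlag Pol.lines E ∧ ∀ F ∈ E, T ⊂ F) (fun E h => h.1) ∅
    ⟨empty_flag _, fun _ h => h.elim⟩
  have hTne : T.Nonempty := (Set.nonempty_of_ssubset hST).mono Set.sdiff_subset
  have hEmem : ∀ F, IsSingular Pol.lines F → T ⊂ F → (∀ G ∈ E, F ⊆ G ∨ G ⊆ F) → F ∈ E := by
    intro F hF hTF hcomp
    by_contra hn'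
    have h3 := hEm (insert F E) ⟨flag_insert hE hF (hTne.mono hTF.1) hcomp, by
      rintro G (rfl | hG)
      · exact hTF
      · exact hET G hG⟩
    rw [Set.ncard_insert_of_notMem hn' (flag_finite Pol hn hE).1] at h3
    omega
  have hTC : T ∈ C := mem_max_flag Pol hn hC hC1 hT hTne subset_rfl (fun F hF => Or.inr (hC.2 F hF))
  have comp : ∀ {K : Set (Set P)} {F G : Set P}, IsFlag Pol.lines K → F ∈ K → G ∈ K →
      F ⊆ G ∨ G ⊆ F := by
    intro K F G hK hF hG
    exact hK.1.total hF hG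
  have union_flag : ∀ {K : Set (Set P)}, IsFlagIn Pol.lines T K → IsFlag Pol.lines (K ∪ E) := by
    intro K hK
    refine ⟨?_, ?_⟩
    · rintro F (hF | hF) G (hG | hG) -
      · exact comp hK.1 hF hG
      · exact Or.inl ((hK.2 F hF).trans (hET G hG).1)
      · exact Or.inr ((hK.2 G hG).trans (hET F hF).1)
      · exact comp hE hF hG
    · rintro F (hF | hF)
      · exact hK.1.2 F hF
      · exact hE.2 F hF
  have key : ∀ {K : Set (Set P)}, IsFlagIn Pol.lines T K → T ∈ K →
      (∀ F, IsSingular Pol.lines F → F.Nonempty → F ⊆ T → (∀ G ∈ K, F ⊆ G ∨ G ⊆ F) → F ∈ K) →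
      K.ncard + E.ncard = n := by
    intro K hK hTK hmax
    rw [← Pol.flag_card (K ∪ E) (union_flag hK), Set.ncard_union_eq
      (Set.disjoint_left.mpr fun F hF hF' => (hET F hF').2 (hK.2 F hF))
      (flag_finite Pol hn hK.1).1 (flag_finite Pol hn hE).1]
    · intro C' hC' hsub
      refine hsub.antisymm ?_
      intro F hF
      have hc : ∀ G ∈ K ∪ E, F ⊆ G ∨ G ⊆ F := fun G hG => comp hC' hF (hsub hG)
      have hF1 := hC'.2 F hF
      by_cases hFT : F ⊆ T
      · exact Or.inl (hmax F hF1.1 hF1.2 hFT (fun G hG => hc G (Or.inl hG)))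
      · refine Or.inr (hEmem F hF1.1 ⟨?_, hFT⟩ (fun G hG => hc G (Or.inr hG)))
        exact (hc T (Or.inl hTK)).resolve_left hFT
  have h1 := key hC hTC (fun F hF hne hFT hc => mem_max_flag Pol hn hC hC1 hF hne hFT hc)
  have hTD : T ∉ D := fun h => hST.2 (hD.2 T h)
  have h2 : (insert T D).ncard + E.ncard = n := by
    refine key ⟨flag_insert hD.1 hT hTne (fun F hF => Or.inr ((hD.2 F hF).trans hST.1)), ?_⟩
      (Or.inl rfl) ?_
    · rintro F (rfl | hF)
      · exact subset_rfl
      · exact (hD.2 F hF).trans hST.1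
    · intro F hF hne hFT hc
      by_cases hFS : F ⊆ S
      · exact Or.inr (mem_max_flag Pol hn hD hD1 hF hne hFS (fun G hG => hc G (Or.inr hG)))
      · have hSF : S ⊆ F := by
          by_cases hSne : S.Nonempty
          · have hSD : S ∈ D := mem_max_flag Pol hn hD hD1 hS hSne subset_rfl
              (fun F hF => Or.inr (hD.2 F hF))
            exact (hc S (Or.inr hSD)).resolve_left hFS
          · rw [Set.not_nonempty_iff_eq_empty] at hSne
            rw [hSne]; exact Set.empty_subset _
        rcases hcov F hF hSF hFT with h | h
        · exact absurd h.subset hFS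
        · exact Or.inl h
  rw [Set.ncard_insert_of_notMem hTD (flag_finite Pol hn hD.1).1] at h2
  omega

theorem exists_max (Pol : PolarSpace P n) (hn : 3 ≤ n) {S : Set P}
    (hS : IsSingular Pol.lines S) :
    ∃ M, IsSingular Pol.lines M ∧ S ⊆ M ∧ rk Pol.lines M = n := by
  have hb : BddAbove (rk Pol.lines '' {M | IsSingular Pol.lines M ∧ S ⊆ M}) := by
    refine ⟨n, ?_⟩
    rintro _ ⟨M, -, rfl⟩
    exact rk_le Pol hn M
  obtain ⟨M, ⟨hM, hSM⟩, h⟩ := Nat.sSup_mem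
    (Set.Nonempty.image (rk Pol.lines)
      (s := {M | IsSingular Pol.lines M ∧ S ⊆ M}) ⟨S, hS, subset_rfl⟩) hb
  have hmax : ∀ F, IsSingular Pol.lines F → M ⊆ F → M = F := by
    intro F hF hMF
    refine eq_of_rk_le Pol hn hF hMF ?_
    rw [h]
    exact le_csSup hb ⟨F, ⟨hF, hSM.trans hMF⟩, rfl⟩
  refine ⟨M, hM, hSM, ?_⟩
  obtain ⟨C, hC, hC1, -⟩ := rk_spec Pol hn M
  rw [← hC1]
  refine Pol.flag_card C hC.1 ?_
  intro C' hC' hsub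
  refine hsub.antisymm ?_
  intro F hF
  have hF1 := hC'.2 F hF
  refine mem_max_flag Pol hn hC hC1 hF1.1 hF1.2 ?_ (fun G hG => hC'.1.total hF (hsub hG))
  by_cases hMne : M.Nonempty
  · have hMC : M ∈ C := mem_max_flag Pol hn hC hC1 hM hMne subset_rfl
      (fun F hF => Or.inr (hC.2 F hF))
    rcases hC'.1.total hF (hsub hMC) with h | h
    · exact h
    · exact (hmax F hF1.1 h).symm.subset
  · rw [Set.not_nonempty_iff_eq_empty] at hMne
    exact (hmax F hF1.1 (by rw [hMne]; exact Set.empty_subset _)).symm.subset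

theorem insert_clique {l : Set (Set P)} {S : Set P} {p : P} (hS : S ⊆ perp l S)
    (hp : p ∈ perp l S) : insert p S ⊆ perp l (insert p S) := by
  rintro x (rfl | hx) y (rfl | hy)
  · exact col_refl _
  · exact hp y hy
  · exact col_symm (hp x hx)
  · exact hS hx y hy

theorem union_clique {l : Set (Set P)} {S T : Set P} (hS : S ⊆ perp l S)
    (hT : T ⊆ perp l T) (hST : S ⊆ perp l T) : S ∪ T ⊆ perp l (S ∪ T) := by
  rw [perp_union]
  rintro x (hx | hx)
  · exact ⟨hS hx, hST hx⟩
  · exact ⟨subset_perp_comm hST hx, hT hx⟩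

theorem max_perp (Pol : PolarSpace P n) (hn : 3 ≤ n) {M : Set P}
    (hM : IsSingular Pol.lines M) (hr : rk Pol.lines M = n) :
    perp Pol.lines M = M := by
  refine Set.Subset.antisymm ?_ (sing_perp hM)
  intro y hy
  have h1 := span_sing Pol (insert_clique (sing_perp hM) hy)
  have h2 : M ⊆ span Pol.lines (insert y M) := (Set.subset_insert _ _).trans (subset_span _)
  rw [eq_of_rk_le Pol hn h1 h2 (by rw [hr]; exact rk_le Pol hn _)]
  exact subset_span _ (Or.inl rfl)

/-- `S ∩ p ⊥` is generating together with any further point of `S`. -/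
theorem span_hyper (Pol : PolarSpace P n) {S : Set P} (hS : IsSingular Pol.lines S)
    {p q : P} (hq : q ∈ S) (hpq : ¬ Col Pol.lines p q) :
    span Pol.lines (insert q (S ∩ perp Pol.lines {p})) = S := by
  apply Set.Subset.antisymm
  · exact span_le hS.1 (Set.insert_subset hq Set.inter_subset_left)
  · intro r hr
    rcases hS.2 q hq r hr with rfl | ⟨L, hL, hqL, hrL⟩
    · exact subset_span _ (Or.inl rfl)
    · by_cases hqr : q = r
      · subst hqr; exact subset_span _ (Or.inl rfl)
      have hLS : L ⊆ S := hS.1 q hq r hr hqr L hL hqL hrL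
      obtain ⟨h, hhL, hph⟩ : ∃ h ∈ L, Col Pol.lines p h := by
        rcases Pol.one_or_all p L hL with ⟨h, hh, -⟩ | h
        · exact ⟨h, hh⟩
        · exact ⟨q, hqL, h q hqL⟩
      have hqh : q ≠ h := by rintro rfl; exact hpq hph
      refine span_subspace _ q (subset_span _ (Or.inl rfl)) h (subset_span _ (Or.inr
        ⟨hLS hhL, ?_⟩)) hqh L hL hqL hhL hrL
      rintro x rfl
      exact hph

theorem rk_hyper (Pol : PolarSpace P n) (hn : 3 ≤ n) {S : Set P}
    (hS : IsSingular Pol.lines S)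
    {p q : P} (hq : q ∈ S) (hpq : ¬ Col Pol.lines p q) :
    rk Pol.lines S = rk Pol.lines (S ∩ perp Pol.lines {p}) + 1 := by
  refine rk_cover Pol hn hS (inter_perp_sing Pol hS _) ⟨Set.inter_subset_left, fun h =>
    hpq ((h hq).2 p rfl)⟩ ?_
  intro F hF h1 h2
  by_cases h : F ⊆ perp Pol.lines {p}
  · exact Or.inl ((Set.subset_inter h2 h).antisymm h1)
  · right
    obtain ⟨x, hx, hxp⟩ := Set.not_subset.mp h
    refine h2.antisymm ?_
    rw [← span_hyper Pol hS (h2 hx) (p := p) (fun hc => hxp (by rintro y rfl; exact hc))]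
    exact span_le hF.1 (Set.insert_subset hx h1)

theorem rk_hyper_le (Pol : PolarSpace P n) (hn : 3 ≤ n) {S : Set P}
    (hS : IsSingular Pol.lines S) (p : P) :
    rk Pol.lines S ≤ rk Pol.lines (S ∩ perp Pol.lines {p}) + 1 := by
  by_cases h : S ⊆ perp Pol.lines {p}
  · rw [Set.inter_eq_left.mpr h]; omega
  · obtain ⟨x, hx, hxp⟩ := Set.not_subset.mp h
    exact (rk_hyper Pol hn hS hx (p := p) (fun hc => hxp (by rintro y rfl; exact hc))).le

theorem perp_insert {l : Set (Set P)} (x : P) (X : Set P) :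
    perp l (insert x X) = perp l X ∩ perp l {x} := by
  rw [Set.insert_eq, perp_union, Set.inter_comm]

theorem rk_finset (Pol : PolarSpace P n) (hn : 3 ≤ n) {S : Set P}
    (hS : IsSingular Pol.lines S) (F : Finset P) :
    rk Pol.lines S ≤ rk Pol.lines (S ∩ perp Pol.lines F) + F.card := by
  classical
  induction F using Finset.induction_on with
  | empty =>
    have : perp Pol.lines ((∅ : Finset P) : Set P) = Set.univ := by
      ext x; simp [perp]
    rw [this]; simp
  | insert a F ha ih =>
    rw [Finset.coe_insert, perp_insert, ← Set.inter_assoc, Finset.card_insert_of_notMem ha]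
    have := rk_hyper_le Pol hn (inter_perp_sing Pol hS (F : Set P)) a
    omega

/-- Generating a singular subspace over a smaller one. -/
theorem exists_gen (Pol : PolarSpace P n) (hn : 3 ≤ n) {T : Set P}
    (hT : IsSingular Pol.lines T) (m : ℕ) : ∀ {S : Set P}, IsSingular Pol.lines S → S ⊆ T →
    rk Pol.lines T ≤ rk Pol.lines S + m →
    ∃ F : Finset P, F.card + rk Pol.lines S ≤ rk Pol.lines T ∧
      T = span Pol.lines (S ∪ F) := by
  classical
  induction m with
  | zero =>
    intro S hS hST h
    have := eq_of_rk_le Pol hn hT hST (by simpa using h)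
    subst this
    refine ⟨∅, by simp, ?_⟩
    simp [span_self hS.1]
  | succ m ih =>
    intro S hS hST h
    rcases hST.eq_or_ssubset with rfl | hss
    · refine ⟨∅, by simp, ?_⟩
      simp [span_self hS.1]
    · obtain ⟨t, ht, htS⟩ := Set.exists_of_ssubset hss
      have htp : t ∈ perp Pol.lines S := fun x hx => hT.2 x (hST hx) t ht
      have hS' := span_sing Pol (insert_clique (sing_perp hS) htp)
      have hlt : rk Pol.lines S < rk Pol.lines (span Pol.lines (insert t S)) := by
        refine rk_lt Pol hn hS' ⟨(Set.subset_insert _ _).trans (subset_span _), fun hh => ?_⟩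
        exact htS (hh (subset_span _ (Or.inl rfl)))
      obtain ⟨F, hF, hTF⟩ := ih hS' (span_le hT.1 (Set.insert_subset ht hST)) (by omega)
      refine ⟨insert t F, ?_, ?_⟩
      · have := Finset.card_insert_le t F
        omega
      · rw [span_union_span] at hTF
        rw [hTF]
        congr 1
        rw [Finset.coe_insert, Set.insert_union, Set.union_insert]

/-- The fundamental duality inequality. -/
theorem rk_dual (Pol : PolarSpace P n) (hn : 3 ≤ n) {X S T : Set P}
    (hX : IsSingular Pol.lines X) (hS : IsSingular Pol.lines S) (hT : IsSingular Pol.lines T)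
    (hST : S ⊆ T) :
    rk Pol.lines (X ∩ perp Pol.lines S) + rk Pol.lines S ≤
      rk Pol.lines (X ∩ perp Pol.lines T) + rk Pol.lines T := by
  obtain ⟨F, hF, hTF⟩ := exists_gen Pol hn hT _ hS hST (Nat.le_add_left _ _)
  have h1 : perp Pol.lines T = perp Pol.lines S ∩ perp Pol.lines F := by
    rw [← perp_union, ← perp_span Pol (S ∪ F), ← hTF]
  have h2 := rk_finset Pol hn (inter_perp_sing Pol hX S) F
  rw [h1, ← Set.inter_assoc]
  omega

theorem perp_empty {l : Set (Set P)} : perp l (∅ : Set P) = Set.univ := by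
  ext x; simp [perp]

theorem exists_opp_of (Pol : PolarSpace P n) (hn : 3 ≤ n) {Q M : Set P}
    (hQ : IsSingular Pol.lines Q) (hM : IsSingular Pol.lines M)
    (h : ∀ p ∈ M, p ∉ Q → p ∈ perp Pol.lines Q →
      ∃ q ∈ perp Pol.lines Q, ¬ Col Pol.lines q p) :
    ∃ N, IsSingular Pol.lines N ∧ Q ⊆ N ∧ rk Pol.lines N = n ∧ N ∩ M ⊆ Q := by
  have hne : (rk Pol.lines '' ((· ∩ M) '' {N | IsSingular Pol.lines N ∧ Q ⊆ N ∧
      rk Pol.lines N = n})).Nonempty := by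
    obtain ⟨N, h1, h2, h3⟩ := exists_max Pol hn hQ
    exact ⟨_, _, ⟨N, ⟨h1, h2, h3⟩, rfl⟩, rfl⟩
  obtain ⟨_, ⟨N, ⟨hN, hQN, hr⟩, rfl⟩, hmin⟩ := Nat.sInf_mem hne
  refine ⟨N, hN, hQN, hr, ?_⟩
  by_contra hcon
  obtain ⟨p, ⟨hpN, hpM⟩, hpQ⟩ := Set.not_subset.mp hcon
  obtain ⟨q, hqQ, hqp⟩ := h p hpM hpQ (fun x hx => hN.2 x (hQN hx) p hpN)
  set H := N ∩ perp Pol.lines {q} with hH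
  have hHs : IsSingular Pol.lines H := inter_perp_sing Pol hN _
  have hrH : rk Pol.lines N = rk Pol.lines H + 1 := rk_hyper Pol hn hN hpN hqp
  have hqH : q ∈ perp Pol.lines H := fun x hx => col_symm (hx.2 q rfl)
  have hN' := span_sing Pol (insert_clique (sing_perp hHs) hqH)
  set N' := span Pol.lines (insert q H) with hN'def
  have hHN' : H ⊆ N' := (Set.subset_insert _ _).trans (subset_span _)
  have hpN' : Col Pol.lines p q → False := fun hc => hqp (col_symm hc)
  have hqN : q ∉ N := fun hq => hqp (hN.2 q hq p hpN)
  have hrN' : rk Pol.lines N' = n := by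
    have h1 : rk Pol.lines H < rk Pol.lines N' := rk_lt Pol hn hN' ⟨hHN', fun hh =>
      hqN (hh (subset_span _ (Or.inl rfl))).1⟩
    have := rk_le Pol hn N'
    omega
  have hQN' : Q ⊆ N' := fun x hx => hHN' ⟨hQN hx, by
    rintro y rfl
    exact col_symm (hqQ x hx)⟩
  have hsub : N' ∩ M ⊆ (N ∩ M) ∩ perp Pol.lines {q} := by
    rintro y ⟨hyN', hyM⟩
    have hyq : y ∈ perp Pol.lines {q} := by
      rintro x rfl
      exact hN'.2 x (subset_span _ (Or.inl rfl)) y hyN'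
    refine ⟨⟨?_, hyM⟩, hyq⟩
    rw [← max_perp Pol hn hN hr, ← span_hyper Pol hN hpN hqp, perp_span, perp_insert]
    refine ⟨fun x hx => hN'.2 x (hHN' hx) y hyN', ?_⟩
    rintro x rfl
    exact hM.2 x hpM y hyM
  have hNM := inter_sing hN hM.1
  have hlt : rk Pol.lines (N' ∩ M) < rk Pol.lines (N ∩ M) := by
    refine rk_lt Pol hn hNM ⟨fun x hx => (hsub hx).1, fun hh => ?_⟩
    exact hqp ((hsub (hh ⟨hpN, hpM⟩)).2 q rfl)
  have := Nat.sInf_le (s := rk Pol.lines '' ((· ∩ M) '' {N | IsSingular Pol.lines N ∧ Q ⊆ N ∧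
      rk Pol.lines N = n})) ⟨_, ⟨N', ⟨hN', hQN', hrN'⟩, rfl⟩, rfl⟩
  rw [← hmin] at this
  simp only at this
  omega

/-- Non-degeneracy of residues. -/
theorem exists_not_col (Pol : PolarSpace P n) (hn : 3 ≤ n) {X : Set P} {p : P}
    (hX : IsSingular Pol.lines X) (hp : p ∈ perp Pol.lines X) (hpX : p ∉ X) :
    ∃ q ∈ perp Pol.lines X, ¬ Col Pol.lines q p := by
  by_contra hcon
  push Not at hcon
  obtain ⟨M, hM, hXM, hrM⟩ := exists_max Pol hn
    (span_sing Pol (insert_clique (sing_perp hX) hp))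
  have hXM' : insert p X ⊆ M := (subset_span _).trans hXM
  obtain ⟨N, hN, -, hrN, hNM⟩ := exists_opp_of Pol hn (empty_sing _) hM (by
    intro p _ _ _
    obtain ⟨q, hq⟩ := Pol.no_center p
    exact ⟨q, fun _ h => h.elim, fun hc => hq (col_symm hc)⟩)
  have h1 := rk_dual Pol hn hN (empty_sing _) hX (Set.empty_subset _)
  rw [perp_empty, Set.inter_univ, rk_empty Pol hn, hrN] at h1
  have hZ := inter_perp_sing Pol hN X
  have h2 := rk_dual Pol hn hM hZ hN Set.inter_subset_left
  rw [max_perp Pol hn hN hrN] at h2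
  have h3 : M ∩ N = ∅ := by
    rw [Set.inter_comm]; exact Set.subset_empty_iff.mp hNM
  rw [h3, rk_empty Pol hn] at h2
  have h4 : rk Pol.lines X <
      rk Pol.lines (M ∩ perp Pol.lines (N ∩ perp Pol.lines X)) := by
    refine rk_lt Pol hn (inter_perp_sing Pol hM _) ⟨?_, fun hh => hpX (hh ⟨hXM' (Or.inl rfl), ?_⟩)⟩
    · intro x hx
      exact ⟨hXM' (Or.inr hx), fun y hy => col_symm (hy.2 x hx)⟩
    · intro y hy
      exact hcon y hy.2
  omega

theorem exists_opp (Pol : PolarSpace P n) (hn : 3 ≤ n) {Q M : Set P}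
    (hQ : IsSingular Pol.lines Q) (hM : IsSingular Pol.lines M) :
    ∃ N, IsSingular Pol.lines N ∧ Q ⊆ N ∧ rk Pol.lines N = n ∧ N ∩ M ⊆ Q :=
  exists_opp_of Pol hn hQ hM (fun _ _ h1 h2 => exists_not_col Pol hn hQ h2 h1)

theorem rk_modular (Pol : PolarSpace P n) (hn : 3 ≤ n) {X Y : Set P}
    (hX : IsSingular Pol.lines X) (hY : IsSingular Pol.lines Y) (hXY : X ⊆ perp Pol.lines Y) :
    rk Pol.lines X + rk Pol.lines Y ≤
      rk Pol.lines (X ∩ Y) + rk Pol.lines (span Pol.lines (X ∪ Y)) := by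
  have hW := span_sing Pol (union_clique (sing_perp hX) (sing_perp hY) hXY)
  set W := span Pol.lines (X ∪ Y)
  have hXW : X ⊆ W := Set.subset_union_left.trans (subset_span _)
  have hYW : Y ⊆ W := Set.subset_union_right.trans (subset_span _)
  obtain ⟨M, hM, hWM, hrM⟩ := exists_max Pol hn hW
  obtain ⟨N, hN, hYN, hrN, hNM⟩ := exists_opp Pol hn hY hM
  have h1 := rk_dual Pol hn hN hY hW hYW
  rw [Set.inter_eq_left.mpr ((sing_perp hN).trans (perp_anti hYN)), hrN] at h1
  have h2 := rk_dual Pol hn hX (inter_perp_sing Pol hN W) hN Set.inter_subset_left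
  have h3 : X ⊆ perp Pol.lines (N ∩ perp Pol.lines W) :=
    fun x hx y hy => col_symm (hy.2 x (hXW hx))
  rw [Set.inter_eq_left.mpr h3, max_perp Pol hn hN hrN, hrN] at h2
  have h4 : rk Pol.lines (X ∩ N) ≤ rk Pol.lines (X ∩ Y) :=
    rk_mono Pol hn (inter_sing hX hY.1) (fun x hx => ⟨hx.1, hNM ⟨hx.2, hWM (hXW hx.1)⟩⟩)
  omega

theorem rk_exchange (Pol : PolarSpace P n) (hn : 3 ≤ n) {X : Set P} {p : P}
    (hX : IsSingular Pol.lines X) (hp : p ∈ perp Pol.lines X) :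
    rk Pol.lines (span Pol.lines (insert p X)) ≤ rk Pol.lines X + 1 := by
  have hW := span_sing Pol (insert_clique (sing_perp hX) hp)
  obtain ⟨M, hM, hWM, hrM⟩ := exists_max Pol hn hW
  have hXM : insert p X ⊆ M := (subset_span _).trans hWM
  obtain ⟨N, hN, hXN, hrN, hNM⟩ := exists_opp Pol hn hX hM
  have h1 := rk_hyper_le Pol hn hN p
  have h2 := rk_dual Pol hn hM (inter_perp_sing Pol hN {p}) hN Set.inter_subset_left
  rw [max_perp Pol hn hN hrN] at h2
  have h3 : rk Pol.lines (M ∩ N) ≤ rk Pol.lines X :=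
    rk_mono Pol hn hX (fun x hx => hNM ⟨hx.2, hx.1⟩)
  have hsing := inter_perp_sing Pol hM (N ∩ perp Pol.lines {p})
  have h4 : rk Pol.lines (span Pol.lines (insert p X)) ≤
      rk Pol.lines (M ∩ perp Pol.lines (N ∩ perp Pol.lines {p})) := by
    refine rk_mono Pol hn hsing (span_le hsing.1 (Set.insert_subset ?_ ?_))
    · exact ⟨hXM (Or.inl rfl), fun y hy => col_symm (hy.2 p rfl)⟩
    · exact fun x hx => ⟨hXM (Or.inr hx), fun y hy => hN.2 y hy.1 x (hXN hx)⟩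
  omega

/-- Splitting off hyperbolic pairs from two singular subspaces. -/
theorem exists_split (Pol : PolarSpace P n) (hn : 3 ≤ n) (m : ℕ) : ∀ {S U : Set P},
    IsSingular Pol.lines S → IsSingular Pol.lines U → rk Pol.lines S ≤ m →
    ∃ (S₁ U₁ : Set P) (X : Finset P) (f : P → P),
      IsSingular Pol.lines S₁ ∧ IsSingular Pol.lines U₁ ∧ S₁ ⊆ S ∧ U₁ ⊆ U ∧
      (X : Set P) ⊆ S ∧ f '' X ⊆ U ∧ S₁ ⊆ perp Pol.lines U₁ ∧
      S₁ ⊆ perp Pol.lines (f '' X) ∧ U₁ ⊆ perp Pol.lines X ∧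
      (∀ x ∈ X, ∀ y ∈ X, Col Pol.lines x (f y) ↔ x ≠ y) ∧
      S = span Pol.lines (S₁ ∪ X) ∧ U = span Pol.lines (U₁ ∪ f '' X) := by
  classical
  have base : ∀ {S U : Set P}, IsSingular Pol.lines S → IsSingular Pol.lines U →
      S ⊆ perp Pol.lines U → ∃ (S₁ U₁ : Set P) (X : Finset P) (f : P → P),
      IsSingular Pol.lines S₁ ∧ IsSingular Pol.lines U₁ ∧ S₁ ⊆ S ∧ U₁ ⊆ U ∧
      (X : Set P) ⊆ S ∧ f '' X ⊆ U ∧ S₁ ⊆ perp Pol.lines U₁ ∧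
      S₁ ⊆ perp Pol.lines (f '' X) ∧ U₁ ⊆ perp Pol.lines X ∧
      (∀ x ∈ X, ∀ y ∈ X, Col Pol.lines x (f y) ↔ x ≠ y) ∧
      S = span Pol.lines (S₁ ∪ X) ∧ U = span Pol.lines (U₁ ∪ f '' X) := by
    intro S U hS hU h
    refine ⟨S, U, ∅, id, hS, hU, subset_rfl, subset_rfl, by simp, by simp, h, ?_, ?_, by simp,
      ?_, ?_⟩
    · simp [perp_empty]
    · simp [perp_empty]
    · simp [span_self hS.1]
    · simp [span_self hU.1]
  induction m with
  | zero =>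
    intro S U hS hU hr
    refine base hS hU ?_
    have : S = ∅ := by
      by_contra hne
      have := rk_lt Pol hn hS (Set.ssubset_iff_subset_ne.mpr ⟨Set.empty_subset S, Ne.symm hne⟩)
      omega
    rw [this]; exact Set.empty_subset _
  | succ m ih =>
    intro S U hS hU hr
    by_cases hSU : S ⊆ perp Pol.lines U
    · exact base hS hU hSU
    obtain ⟨p, hp, hpU⟩ := Set.not_subset.mp hSU
    simp only [perp, Set.mem_ofPred_eq, not_forall] at hpU
    obtain ⟨q, hq, hqp⟩ := hpU
    have hpq : ¬ Col Pol.lines p q := fun h => hqp (col_symm h)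
    have hrS := rk_hyper Pol hn hS hp hqp
    obtain ⟨S₁, U₁, X, f, hS₁, hU₁, hS₁S, hU₁U, hXS, hfU, h1, h2, h3, h4, h5, h6⟩ :=
      ih (inter_perp_sing Pol hS {q}) (inter_perp_sing Pol hU {p}) (by omega)
    have hpX : p ∉ X := fun h => hqp ((hXS h).2 q rfl)
    have hf' : ∀ x ∈ X, Function.update f p q x = f x := by
      intro x hx
      rw [Function.update_of_ne]
      rintro rfl; exact hpX hx
    have himg : Function.update f p q '' ((insert p X : Finset P) : Set P) =
        insert q (f '' X) := by
      rw [Finset.coe_insert, Set.image_insert_eq, Function.update_self]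
      congr 1
      exact Set.image_congr hf'
    have hS2 := span_hyper Pol hS hp hqp
    have hU2 := span_hyper Pol hU hq hpq
    refine ⟨S₁, U₁, insert p X, Function.update f p q, hS₁, hU₁,
      hS₁S.trans Set.inter_subset_left, hU₁U.trans Set.inter_subset_left, ?_, ?_, h1, ?_, ?_, ?_,
      ?_, ?_⟩
    · rw [Finset.coe_insert]
      exact Set.insert_subset hp (hXS.trans Set.inter_subset_left)
    · rw [himg]
      exact Set.insert_subset hq (hfU.trans Set.inter_subset_left)
    · rw [himg, perp_insert]
      exact Set.subset_inter h2 (hS₁S.trans Set.inter_subset_right)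
    · rw [Finset.coe_insert, perp_insert]
      exact Set.subset_inter h3 (hU₁U.trans Set.inter_subset_right)
    · intro x hx y hy
      rw [Finset.mem_insert] at hx hy
      rcases hx with rfl | hx <;> rcases hy with rfl | hy
      · simp [hpq]
      · rw [hf' y hy]
        have a1 : Col Pol.lines x (f y) := (hfU ⟨y, hy, rfl⟩).2 x rfl
        have a2 : x ≠ y := by rintro rfl; exact hpX hy
        simp [a1, a2]
      · rw [Function.update_self]
        have a1 : Col Pol.lines x q := col_symm ((hXS hx).2 q rfl)
        have a2 : x ≠ y := by rintro rfl; exact hpX hx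
        simp [a1, a2]
      · rw [hf' y hy]
        exact h4 x hx y hy
    · rw [← hS2, h5, Finset.coe_insert, Set.insert_eq, span_union_span']
      congr 1
      rw [Set.union_insert, Set.insert_eq]
    · rw [himg, ← hU2, h6, Set.insert_eq, span_union_span']
      congr 1
      rw [Set.union_insert, Set.insert_eq]

/-- A generating set of the span of two orthogonal singular subspaces, adapted to both. -/
theorem exists_adapted (Pol : PolarSpace P n) (hn : 3 ≤ n) {S U : Set P}
    (hS : IsSingular Pol.lines S) (hU : IsSingular Pol.lines U) (h : S ⊆ perp Pol.lines U) :
    ∃ A B : Finset P, S = span Pol.lines A ∧ U = span Pol.lines B ∧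
      (Set.ncard ((A : Set P) ∪ B)) ≤ rk Pol.lines (span Pol.lines (S ∪ U)) := by
  classical
  have hI := inter_sing hS hU.1
  obtain ⟨F, hF, hF'⟩ := exists_gen Pol hn hI _ (empty_sing _) (Set.empty_subset _)
    (Nat.le_add_left _ _)
  obtain ⟨G, hG, hG'⟩ := exists_gen Pol hn hS _ hI Set.inter_subset_left
    (Nat.le_add_left _ _)
  obtain ⟨H, hH, hH'⟩ := exists_gen Pol hn hU _ hI Set.inter_subset_right
    (Nat.le_add_left _ _)
  rw [Set.empty_union] at hF'
  refine ⟨F ∪ G, F ∪ H, ?_, ?_, ?_⟩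
  · rw [Finset.coe_union, ← span_union_span, ← hF']
    exact hG'
  · rw [Finset.coe_union, ← span_union_span, ← hF']
    exact hH'
  · have h1 := rk_modular Pol hn hS hU h
    have h2 : ((F ∪ G : Finset P) : Set P) ∪ ((F ∪ H : Finset P) : Set P) =
        ((F ∪ (G ∪ H) : Finset P) : Set P) := by
      push_cast
      ext x; simp only [Set.mem_union]; tauto
    rw [h2, Set.ncard_coe_finset]
    have h3 := Finset.card_union_le F (G ∪ H)
    have h4 := Finset.card_union_le G H
    omega

theorem span_inter_perp (Pol : PolarSpace P n) (hn : 3 ≤ n) (f : P → P) (D : Finset P)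
    (hcl : f '' D ⊆ perp Pol.lines (f '' D))
    (h : ∀ x ∈ D, ∀ y ∈ D, Col Pol.lines x (f y) ↔ x ≠ y) :
    span Pol.lines (f '' D) ∩ perp Pol.lines D = ∅ := by
  classical
  induction D using Finset.induction_on with
  | empty =>
    have : span Pol.lines (f '' ((∅ : Finset P) : Set P)) ⊆ ∅ :=
      span_le (empty_sing _).1 (by simp)
    rw [Set.subset_empty_iff.mp this, Set.empty_inter]
  | insert d D hd ih =>
    have hsub : f '' D ⊆ f '' ((insert d D : Finset P) : Set P) :=
      Set.image_mono (by simp)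
    have hclD : f '' D ⊆ perp Pol.lines (f '' D) := (hsub.trans hcl).trans (perp_anti hsub)
    have ih' := ih hclD (fun x hx y hy =>
      h x (Finset.mem_insert_of_mem hx) y (Finset.mem_insert_of_mem hy))
    have hV := span_sing Pol hclD
    have hfd : f d ∈ f '' ((insert d D : Finset P) : Set P) := ⟨d, by simp, rfl⟩
    have hfp : f d ∈ perp Pol.lines (span Pol.lines (f '' D)) := by
      rw [perp_span]
      exact perp_anti hsub (hcl hfd)
    have hW : span Pol.lines (f '' ((insert d D : Finset P) : Set P)) =
        span Pol.lines (insert (f d) (span Pol.lines (f '' D))) := by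
      rw [Finset.coe_insert, Set.image_insert_eq, Set.insert_eq, Set.insert_eq, span_union_span']
    have hWs := span_sing Pol hcl
    have hdd : ¬ Col Pol.lines d (f d) := by
      rw [h d (Finset.mem_insert_self _ _) d (Finset.mem_insert_self _ _)]; simp
    have h1 := rk_hyper Pol hn hWs (subset_span _ hfd) hdd
    have h2 := rk_exchange Pol hn hV hfp
    rw [← hW] at h2
    have h3 : span Pol.lines (f '' D) =
        span Pol.lines (f '' ((insert d D : Finset P) : Set P)) ∩ perp Pol.lines {d} := by
      refine eq_of_rk_le Pol hn (inter_perp_sing Pol hWs _) (Set.subset_inter (span_mono hsub) ?_)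
        (by omega)
      refine span_le (perp_subspace Pol _) ?_
      rintro _ ⟨y, hy, rfl⟩ x rfl
      rw [h x (Finset.mem_insert_self _ _) y (Finset.mem_insert_of_mem hy)]
      rintro rfl; exact hd hy
    rw [Finset.coe_insert, perp_insert, ← Set.subset_empty_iff, ← ih']
    rintro y ⟨hy1, hy2, hy3⟩
    refine ⟨?_, hy2⟩
    rw [h3]
    exact ⟨by simpa using hy1, hy3⟩

theorem rk_strip (Pol : PolarSpace P n) (hn : 3 ≤ n) {M : Set P}
    (hM : IsSingular Pol.lines M) (f : P → P) (D : Finset P)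
    (hD : (D : Set P) ⊆ M)
    (h : ∀ x ∈ D, ∀ y ∈ D, Col Pol.lines x (f y) ↔ x ≠ y) :
    rk Pol.lines (M ∩ perp Pol.lines (f '' D)) + D.card = rk Pol.lines M ∧
      M = span Pol.lines (D ∪ (M ∩ perp Pol.lines (f '' D))) := by
  classical
  induction D using Finset.induction_on with
  | empty => simp [perp_empty, span_self hM.1]
  | insert d D hd ih =>
    have hsub : (D : Set P) ⊆ ((insert d D : Finset P) : Set P) := by simp
    obtain ⟨ih1, ih2⟩ := ih (hsub.trans hD) (fun x hx y hy =>
      h x (Finset.mem_insert_of_mem hx) y (Finset.mem_insert_of_mem hy))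
    have hs := inter_perp_sing Pol hM (f '' D)
    have hdd : ¬ Col Pol.lines (f d) d := by
      intro hc
      exact (h d (Finset.mem_insert_self _ _) d (Finset.mem_insert_self _ _)).mp
        (col_symm hc) rfl
    have hdM : d ∈ M ∩ perp Pol.lines (f '' D) := by
      refine ⟨hD (by simp), ?_⟩
      rintro _ ⟨y, hy, rfl⟩
      refine col_symm ((h d (Finset.mem_insert_self _ _) y (Finset.mem_insert_of_mem hy)).mpr ?_)
      rintro rfl; exact hd hy
    have h1 := rk_hyper Pol hn hs hdM hdd
    have h2 := span_hyper Pol hs hdM hdd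
    have h3 : M ∩ perp Pol.lines (f '' ((insert d D : Finset P) : Set P)) =
        (M ∩ perp Pol.lines (f '' D)) ∩ perp Pol.lines {f d} := by
      rw [Finset.coe_insert, Set.image_insert_eq, perp_insert, Set.inter_assoc]
    rw [h3]
    constructor
    · rw [Finset.card_insert_of_notMem hd]; omega
    · conv_lhs => rw [ih2, ← h2, span_union_span']
      congr 1
      rw [Finset.coe_insert, Set.union_insert, Set.insert_union]

/-- A generating set of `n` points of a maximal singular subspace and a dual system in an
opposite one form a base. -/
theorem exists_base_of (Pol : PolarSpace P n) {M N : Set P}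
    (hM : IsSingular Pol.lines M) (hN : IsSingular Pol.lines N) (hNM : N ∩ M = ∅)
    (Y : Finset P) (hY : Y.card = n) (hYM : (Y : Set P) ⊆ M) (g : P → P)
    (hg : ∀ x ∈ Y, g x ∈ N) (hc : ∀ x ∈ Y, ∀ y ∈ Y, Col Pol.lines x (g y) ↔ x ≠ y) :
    ∃ p : Fin (2 * n) → P, IsBase Pol.lines p ∧ Set.range p = (Y : Set P) ∪ g '' Y := by
  classical
  have hcard : Fintype.card (Y ⊕ Y) = 2 * n := by
    rw [Fintype.card_sum, Fintype.card_coe, hY]; omega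
  let e : Fin (2 * n) ≃ (Y ⊕ Y) := (Fintype.equivFinOfCardEq hcard).symm
  let r : Y ⊕ Y → P := Sum.elim (fun x => (x : P)) (fun x => g x)
  have hginj : ∀ x y : Y, g x = g y → x = y := by
    intro x y hxy
    by_contra hne
    have h1 : Col Pol.lines (x : P) (g y) := (hc x x.2 y y.2).mpr (fun h => hne (Subtype.ext h))
    rw [← hxy] at h1
    exact (hc x x.2 x x.2).mp h1 rfl
  have hrinj : Function.Injective r := by
    rintro (x | x) (y | y) hxy
    · exact congrArg Sum.inl (Subtype.ext hxy)
    · have : (x : P) ∈ N ∩ M := ⟨(show (x : P) = g y from hxy) ▸ hg y y.2, hYM x.2⟩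
      rw [hNM] at this; exact this.elim
    · have : (y : P) ∈ N ∩ M := ⟨(show g x = (y : P) from hxy) ▸ hg x x.2, hYM y.2⟩
      rw [hNM] at this; exact this.elim
    · exact congrArg Sum.inr (hginj x y hxy)
  have hcol : ∀ i j, ¬ Col Pol.lines (r i) (r j) ↔ j = i.swap := by
    rintro (x | x) (y | y)
    · simp only [r, Sum.elim_inl, Sum.swap_inl, reduceCtorEq, iff_false, not_not]
      exact hM.2 _ (hYM x.2) _ (hYM y.2)
    · simp only [r, Sum.elim_inl, Sum.elim_inr, Sum.swap_inl, Sum.inr.injEq]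
      rw [hc x x.2 y y.2, not_not, eq_comm, Subtype.ext_iff]
    · simp only [r, Sum.elim_inl, Sum.elim_inr, Sum.swap_inr, Sum.inl.injEq]
      rw [show Col Pol.lines (g x) (y : P) ↔ Col Pol.lines (y : P) (g x) from
        ⟨col_symm, col_symm⟩, hc y y.2 x x.2, not_not, Subtype.ext_iff]
    · simp only [r, Sum.elim_inr, Sum.swap_inr, reduceCtorEq, iff_false, not_not]
      exact hN.2 _ (hg x x.2) _ (hg y y.2)
  refine ⟨r ∘ e, ⟨hrinj.comp e.injective, fun i => ?_⟩, ?_⟩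
  · refine ⟨e.symm (e i).swap, ?_, ?_⟩
    · simp [hcol]
    · intro j hj
      have := (hcol (e i) (e j)).mp hj
      rw [← this, Equiv.symm_apply_apply]
  · rw [Set.range_comp, e.surjective.range_eq, Set.image_univ]
    ext z
    simp [r, Set.mem_range]

theorem exists_base_two (Pol : PolarSpace P n) (hn : 3 ≤ n) {S U : Set P}
    (hS : IsSingular Pol.lines S) (hU : IsSingular Pol.lines U) :
    ∃ p : Fin (2 * n) → P, IsBase Pol.lines p ∧
      (∃ I : Set (Fin (2 * n)), S = span Pol.lines (p '' I)) ∧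
      (∃ I : Set (Fin (2 * n)), U = span Pol.lines (p '' I)) := by
  classical
  obtain ⟨S₁, U₁, X, f, hS₁, hU₁, hS₁S, hU₁U, hXS, hfU, h1, h2, h3, h4, h5, h6⟩ :=
    exists_split Pol hn _ hS hU le_rfl
  obtain ⟨A, B, hA, hB, hAB⟩ := exists_adapted Pol hn hS₁ hU₁ h1
  have hT := span_sing Pol (union_clique (sing_perp hS₁) (sing_perp hU₁) h1)
  have hXcl : (X : Set P) ⊆ perp Pol.lines X :=
    (hXS.trans (sing_perp hS)).trans (perp_anti hXS)
  have hfcl : f '' X ⊆ perp Pol.lines (f '' X) :=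
    (hfU.trans (sing_perp hU)).trans (perp_anti hfU)
  have hTX : span Pol.lines (S₁ ∪ U₁) ⊆ perp Pol.lines X := by
    refine span_le (perp_subspace Pol _) (Set.union_subset ?_ h3)
    exact (hS₁S.trans (sing_perp hS)).trans (perp_anti hXS)
  have hTf : span Pol.lines (S₁ ∪ U₁) ⊆ perp Pol.lines (f '' X) := by
    refine span_le (perp_subspace Pol _) (Set.union_subset h2 ?_)
    exact (hU₁U.trans (sing_perp hU)).trans (perp_anti hfU)
  obtain ⟨M, hM, hTM, hrM⟩ := exists_max Pol hn
    (span_sing Pol (union_clique (sing_perp hT) hXcl hTX))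
  replace hTM := (subset_span _).trans hTM
  have hXM : (X : Set P) ⊆ M := Set.subset_union_right.trans hTM
  replace hTM := Set.subset_union_left.trans hTM
  obtain ⟨N, hN, hQN, hrN, hNM⟩ := exists_opp Pol hn (span_sing Pol hfcl) hM
  replace hNM : N ∩ M = ∅ := by
    rw [← Set.subset_empty_iff, ← span_inter_perp Pol hn f X hfcl h4]
    intro y hy
    exact ⟨hNM hy, perp_anti hXM (sing_perp hM hy.2)⟩
  obtain ⟨hr, hMX⟩ := rk_strip Pol hn hM f X hXM h4
  set M' := M ∩ perp Pol.lines (f '' X) with hM'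
  have hM's : IsSingular Pol.lines M' := inter_perp_sing Pol hM _
  obtain ⟨F, hF, hF'⟩ := exists_gen Pol hn hM's _ hT (Set.subset_inter hTM hTf)
    (Nat.le_add_left _ _)
  have hAB' : span Pol.lines (S₁ ∪ U₁) = span Pol.lines (A ∪ B) := by
    rw [hA, hB, span_union_span, span_union_span']
  rw [hAB', span_union_span] at hF'
  let Y₁ : Finset P := A ∪ B ∪ F
  have hY₁ : M' = span Pol.lines Y₁ := by
    rw [hF']; simp only [Y₁, Finset.coe_union]
  have hY₁c : Y₁.card + X.card ≤ n := by
    have a1 := Finset.card_union_le (A ∪ B) F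
    have a2 : (A ∪ B).card ≤ rk Pol.lines (span Pol.lines (S₁ ∪ U₁)) := by
      rw [← Set.ncard_coe_finset]; push_cast; exact hAB
    have a3 : Y₁.card = (A ∪ B ∪ F).card := rfl
    omega
  let Y : Finset P := X ∪ Y₁
  have hYM : M = span Pol.lines Y := by
    rw [hMX, hY₁, span_union_span']; simp [Y]
  have hNY : N ∩ perp Pol.lines Y = ∅ := by
    rw [← perp_span, ← hYM, max_perp Pol hn hM hrM, hNM]
  have hYc : Y.card = n := by
    have a1 := rk_finset Pol hn hN Y
    rw [hNY, rk_empty Pol hn, hrN] at a1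
    have a2 : Y.card ≤ X.card + Y₁.card := Finset.card_union_le X Y₁
    omega
  have hg : ∀ x ∈ Y, ∃ y, y ∈ N ∧ (∀ z ∈ Y, Col Pol.lines z y ↔ z ≠ x) ∧ (x ∈ X → y = f x) := by
    intro x hx
    suffices ∃ y, y ∈ N ∧ (∀ z ∈ Y, z ≠ x → Col Pol.lines z y) ∧ (x ∈ X → y = f x) by
      obtain ⟨y, hy, hy1, hy2⟩ := this
      refine ⟨y, hy, fun z hz => ⟨?_, hy1 z hz⟩, hy2⟩
      rintro hzy rfl
      have : y ∈ N ∩ perp Pol.lines Y := by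
        refine ⟨hy, fun w hw => ?_⟩
        by_cases hwz : w = z
        · rw [hwz]; exact hzy
        · exact hy1 w hw hwz
      rw [hNY] at this
      exact this.elim
    by_cases hxX : x ∈ X
    · refine ⟨f x, hQN (subset_span _ ⟨x, hxX, rfl⟩), ?_, fun _ => rfl⟩
      intro z hz hzx
      rcases Finset.mem_union.mp hz with hz | hz
      · exact (h4 z hz x hxX).mpr hzx
      · have : z ∈ M' := by rw [hY₁]; exact subset_span _ hz
        exact col_symm (this.2 (f x) ⟨x, hxX, rfl⟩)
    · have a1 := rk_finset Pol hn hN (Y.erase x)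
      rw [Finset.card_erase_of_mem hx, hrN] at a1
      obtain ⟨y, hyN, hy⟩ := nonempty_of_rk_pos Pol hn
        (S := N ∩ perp Pol.lines ((Y.erase x : Finset P) : Set P)) (by omega)
      exact ⟨y, hyN, fun z hz hzx => hy z (by simp [hz, hzx]), fun h => absurd h hxX⟩
  choose! g hgN hgc hgf using hg
  obtain ⟨p, hp, hrange⟩ := exists_base_of Pol hM hN hNM Y hYc
    (by rw [hYM]; exact subset_span _) g hgN (fun x hx y hy => hgc y hy x hx)
  have key : ∀ Z : Set P, Z ⊆ (Y : Set P) ∪ g '' Y → ∃ I : Set (Fin (2 * n)), Z = p '' I := by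
    intro Z hZ
    rw [← hrange] at hZ
    exact ⟨p ⁻¹' Z, (Set.image_preimage_eq_of_subset hZ).symm⟩
  have hXY : (X : Set P) ⊆ Y := by simp [Y]
  have hAY : (A : Set P) ⊆ Y := by
    intro z hz
    simp only [Y, Y₁, Finset.coe_union, Set.mem_union]
    tauto
  have hBY : (B : Set P) ⊆ Y := by
    intro z hz
    simp only [Y, Y₁, Finset.coe_union, Set.mem_union]
    tauto
  refine ⟨p, hp, ?_, ?_⟩
  · obtain ⟨I, hI⟩ := key (A ∪ X) (Set.union_subset hAY hXY |>.trans Set.subset_union_left)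
    exact ⟨I, by rw [← hI, h5, hA, span_union_span]⟩
  · obtain ⟨I, hI⟩ := key (B ∪ f '' X) (by
      refine Set.union_subset (hBY.trans Set.subset_union_left) ?_
      rintro _ ⟨x, hx, rfl⟩
      exact Or.inr ⟨x, hXY hx, hgf x (hXY hx) hx⟩)
    exact ⟨I, by rw [← hI, h6, hB, span_union_span]⟩

end Helpers

end PolarGeo

/-- Proposition 1: any two `k`-dimensional singular subspaces are contained
in a common base subset of `G_k`. -/
theorem exists_base_subset_containing_two
    {P : Type*} {n : ℕ} (Pol : PolarSpace P n) (hn : 3 ≤ n)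
    (k : ℕ) (hk : k ≤ n - 1)
    (S U : Set P) (hS : S ∈ Gdim Pol.lines (k : ℤ)) (hU : U ∈ Gdim Pol.lines (k : ℤ)) :
    ∃ p : Fin (2 * n) → P, IsBase Pol.lines p ∧
      S ∈ baseSubset Pol.lines p (k : ℤ) ∧ U ∈ baseSubset Pol.lines p (k : ℤ) := by
  obtain ⟨p, hp, h1, h2⟩ := exists_base_two Pol hn hS.1 hU.1
  exact ⟨p, hp, ⟨hS, h1⟩, ⟨hU, h2⟩⟩
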